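/- There is no infinite-dimensional Banach space X such that every infinite-dimensional closed subspace of X is an L∞-space. Concretely: if X is an infinite-dimensional Banach space all of whose closed subspaces are locally complemented in X and X is not isomorphic to a Hilbert space, a contradiction follows; since infinite-dimensional Hilbert space contains subspaces that are not L∞-spaces (e.g., itself), no such X exists. -/

import Mathlib

/-- `Z` is an `L∞`-space: for some `λ ≥ 1`, every finite-dimensional subspace is contained
in a finite-dimensional subspace `F` at Banach–Mazur distance at most `λ` from
`ℓ∞^{dim F}` (i.e. `Fin (dim F) → ℝ` with the sup norm). -/
def IsLinftySpace (Z : Type*) [NormedAddCommGroup Z] [NormedSpace ℝ Z] : Prop :=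
  ∃ lam : ℝ, 1 ≤ lam ∧ ∀ E : Submodule ℝ Z, FiniteDimensional ℝ E →
    ∃ F : Submodule ℝ Z, FiniteDimensional ℝ F ∧ E ≤ F ∧
      ∃ e : F ≃L[ℝ] (Fin (Module.finrank ℝ F) → ℝ),
        ‖(e : F →L[ℝ] (Fin (Module.finrank ℝ F) → ℝ))‖ *
          ‖(e.symm : (Fin (Module.finrank ℝ F) → ℝ) →L[ℝ] F)‖ ≤ lam

/-- The sign `±1` attached to a Boolean. -/
def boolSign (b : Bool) : ℝ := if b then 1 else -1

theorem abs_boolSign (b : Bool) : |boolSign b| = 1 := by cases b <;> simp [boolSign]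

/-- The coefficients of a Riesz product on the discrete cube against the coordinate functions. -/
theorem sum_boolSign_mul_prod {ι : Type*} [Fintype ι] [DecidableEq ι] (z : ι → ℂ) (i : ι) :
    ∑ g : ι → Bool, (boolSign (g i) : ℂ) * ∏ j, (1 + (boolSign (g j) : ℂ) * z j) =
      2 ^ Fintype.card ι * z i := by
  have h1 : ∀ g : ι → Bool,
      (boolSign (g i) : ℂ) * ∏ j, (1 + (boolSign (g j) : ℂ) * z j) =
        ∏ j, (if j = i then (boolSign (g j) : ℂ) else 1) *
          (1 + (boolSign (g j) : ℂ) * z j) := by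
    intro g
    rw [Finset.prod_mul_distrib, Finset.prod_ite_eq' Finset.univ i]
    simp
  have h2 : ∀ j, ∑ b : Bool, (if j = i then (boolSign b : ℂ) else 1) *
      (1 + (boolSign b : ℂ) * z j) = 2 * (if j = i then z j else 1) := by
    intro j
    split_ifs <;> simp [boolSign] <;> ring
  simp_rw [h1]
  have := Finset.prod_univ_sum (fun _ : ι ↦ (Finset.univ : Finset Bool))
    (fun j b ↦ (if j = i then (boolSign b : ℂ) else 1) * (1 + (boolSign b : ℂ) * z j))
  rw [Fintype.piFinset_univ] at this
  rw [← this]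
  simp_rw [h2]
  rw [Finset.prod_mul_distrib, Finset.prod_ite_eq' Finset.univ i]
  simp

/-- A point of the cube `[-1, 1]^k`, scaled by `1 / √k`, is the vector of Rademacher coefficients
of a function on the discrete cube which is bounded by `2`. -/
theorem exists_bounded_rademacher_coeff {k : ℕ} (c : Fin k → ℝ) (hc : ∀ i, |c i| ≤ 1) :
    ∃ y : (Fin k → Bool) → ℝ, (∀ g, |y g| ≤ 2) ∧
      ∀ i, ∑ g, boolSign (g i) * y g = 2 ^ k * (c i / √k) := by
  refine ⟨fun g ↦ (∏ j, (1 + (boolSign (g j) : ℂ) * (↑(c j / √k) * Complex.I))).im, ?_, ?_⟩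
  · intro g
    refine (Complex.abs_im_le_norm _).trans (abs_le_of_sq_le_sq' ?_ (by norm_num)).2
    rw [norm_prod, ← Finset.prod_pow]
    calc ∏ j, ‖1 + (boolSign (g j) : ℂ) * (↑(c j / √k) * Complex.I)‖ ^ 2
        ≤ ∏ _j : Fin k, Real.exp (1 / k) := by
          refine Finset.prod_le_prod (fun _ _ ↦ by positivity) fun j _ ↦ ?_
          have h1 : ‖1 + (boolSign (g j) : ℂ) * (↑(c j / √k) * Complex.I)‖ ^ 2 =
              1 + c j ^ 2 / k := by
            rw [Complex.sq_norm, Complex.normSq_apply]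
            have : boolSign (g j) ^ 2 = 1 := by rw [← sq_abs, abs_boolSign, one_pow]
            have hdiv : (c j / √k) ^ 2 = c j ^ 2 / k := by
              rw [div_pow, Real.sq_sqrt (Nat.cast_nonneg k)]
            simp only [Complex.add_re, Complex.one_re, Complex.re_ofReal_mul,
              Complex.I_re, Complex.add_im, Complex.one_im, Complex.im_ofReal_mul, Complex.I_im]
            rw [← hdiv]
            linear_combination (c j / √k) ^ 2 * this
          rw [h1]
          have h2 : c j ^ 2 ≤ 1 := (sq_le_one_iff_abs_le_one _).2 (hc j)
          have h3 : c j ^ 2 / k ≤ 1 / k := by gcongr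
          linarith [Real.add_one_le_exp (1 / (k : ℝ))]
      _ ≤ Real.exp 1 := by
          rw [Finset.prod_const, Finset.card_univ, Fintype.card_fin, ← Real.exp_nat_mul]
          refine Real.exp_le_exp.2 ?_
          rw [mul_one_div]
          exact div_self_le_one _
      _ ≤ 2 ^ 2 := by linarith [Real.exp_one_lt_d9]
  · intro i
    have := congrArg Complex.im
      (sum_boolSign_mul_prod (fun j ↦ (↑(c j / √k) * Complex.I : ℂ)) i)
    rw [Complex.im_sum] at this
    simp only [Complex.im_ofReal_mul] at this
    rw [this, Fintype.card_fin]
    have e : (2 : ℂ) ^ k * (↑(c i / √k) * Complex.I) = ↑(2 ^ k * (c i / √k)) * Complex.I := by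
      push_cast; ring
    rw [e, Complex.im_ofReal_mul, Complex.I_im, mul_one]

/-- In an `L∞`-space, a system of unit-ball vectors `e` and functionals `φ` with `φ i (e i) = 1`
forces the `ℓ¹`-sum of the functionals to be large. -/
theorem exists_sqrt_le_of_isLinftySpace {Z : Type*} [NormedAddCommGroup Z] [NormedSpace ℝ Z]
    (hZ : IsLinftySpace Z) :
    ∃ lam : ℝ, 0 ≤ lam ∧ ∀ (k : ℕ) (e : Fin k → Z) (φ : Fin k → Z →L[ℝ] ℝ) (K : ℝ), 0 ≤ K →
      (∀ i, ‖e i‖ ≤ 1) → (∀ i, φ i (e i) = 1) → (∀ y, ∑ i, |φ i y| ≤ K * ‖y‖) →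
        √k ≤ lam * K := by
  obtain ⟨lam, hlam, h⟩ := hZ
  refine ⟨2 * lam, by positivity, fun k e φ K hK he hφe hφ ↦ ?_⟩
  obtain ⟨F, _, hF, T, hT⟩ := h (Submodule.span ℝ (Set.range e))
    (FiniteDimensional.span_of_finite ℝ (Set.finite_range e))
  set T₁ := (T : F →L[ℝ] (Fin (Module.finrank ℝ F) → ℝ))
  set T₂ := (T.symm : (Fin (Module.finrank ℝ F) → ℝ) →L[ℝ] F)
  have heF : ∀ i, e i ∈ F := fun i ↦ hF (Submodule.subset_span ⟨i, rfl⟩)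
  let v : Fin k → F := fun i ↦ ⟨e i, heF i⟩
  have hTv : ∀ i l, |T₁ (v i) l| ≤ ‖T₁‖ := fun i l ↦
    calc |T₁ (v i) l| ≤ ‖T₁ (v i)‖ := norm_le_pi_norm (T₁ (v i)) l
      _ ≤ ‖T₁‖ * ‖v i‖ := T₁.le_opNorm _
      _ ≤ ‖T₁‖ * 1 := by gcongr; exact he i
      _ = ‖T₁‖ := mul_one _
  have hT₁ : 0 ≤ ‖T₁‖ := norm_nonneg T₁
  have hcoord : ∀ l, ∃ y : (Fin k → Bool) → ℝ, (∀ g, |y g| ≤ ‖T₁‖ * 2) ∧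
      ∀ i, ∑ g, boolSign (g i) * y g = 2 ^ k / √k * T₁ (v i) l := by
    intro l
    obtain ⟨y, hy, hyc⟩ := exists_bounded_rademacher_coeff (fun i ↦ T₁ (v i) l / ‖T₁‖) fun i ↦ by
      rw [abs_div, abs_of_nonneg hT₁]
      exact div_le_one_of_le₀ (hTv i l) hT₁
    refine ⟨fun g ↦ ‖T₁‖ * y g, fun g ↦ ?_, fun i ↦ ?_⟩
    · rw [abs_mul, abs_of_nonneg hT₁]
      gcongr
      exact hy g
    · have : ‖T₁‖ * (T₁ (v i) l / ‖T₁‖) = T₁ (v i) l := by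
        refine mul_div_cancel_of_imp' fun h0 ↦ ?_
        exact abs_nonpos_iff.1 (h0 ▸ hTv i l)
      calc ∑ g, boolSign (g i) * (‖T₁‖ * y g) = ‖T₁‖ * ∑ g, boolSign (g i) * y g := by
            rw [Finset.mul_sum]; exact Finset.sum_congr rfl fun _ _ ↦ by ring
        _ = 2 ^ k / √k * (‖T₁‖ * (T₁ (v i) l / ‖T₁‖)) := by rw [hyc]; ring
        _ = _ := by rw [this]
  choose y hy hyc using hcoord
  let w : (Fin k → Bool) → F := fun g ↦ T₂ fun l ↦ y l g
  have hw : ∀ g, ‖w g‖ ≤ 2 * lam := fun g ↦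
    calc ‖w g‖ ≤ ‖T₂‖ * ‖fun l ↦ y l g‖ := T₂.le_opNorm _
      _ ≤ ‖T₂‖ * (‖T₁‖ * 2) := by
        gcongr
        exact (pi_norm_le_iff_of_nonneg (by positivity)).2 fun l ↦ hy l g
      _ = 2 * (‖T₁‖ * ‖T₂‖) := by ring
      _ ≤ 2 * lam := by gcongr
  have hwe : ∀ i, ∑ g, boolSign (g i) • (w g : Z) = (2 ^ k / √k : ℝ) • e i := by
    intro i
    have h1 : ∑ g, boolSign (g i) • w g = (2 ^ k / √k : ℝ) • v i := by
      have h2 : ∑ g, boolSign (g i) • (fun l ↦ y l g) = (2 ^ k / √k : ℝ) • T₁ (v i) := by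
        ext l
        simpa using hyc l i
      have h3 : T₂ (T₁ (v i)) = v i := T.symm_apply_apply _
      rw [← h3, ← map_smul, ← h2, map_sum]
      simp only [map_smul, w]
    simpa using congrArg (Subtype.val : F → Z) h1
  have hsum : (2 ^ k : ℝ) * √k = ∑ g : Fin k → Bool, ∑ i, boolSign (g i) * φ i (w g) := by
    rw [Finset.sum_comm]
    have : ∀ i, ∑ g : Fin k → Bool, boolSign (g i) * φ i (w g) = 2 ^ k / √k := by
      intro i
      have := congrArg (φ i) (hwe i)
      simpa [hφe] using this
    simp only [this, Finset.sum_const, Finset.card_univ, Fintype.card_fin, nsmul_eq_mul]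
    rw [← mul_div_assoc, mul_comm (k : ℝ), mul_div_assoc, Real.div_sqrt]
  have hle : ∑ g : Fin k → Bool, ∑ i, boolSign (g i) * φ i (w g) ≤
      2 ^ k * (2 * lam * K) := by
    calc _ ≤ ∑ _g : Fin k → Bool, 2 * lam * K := by
          refine Finset.sum_le_sum fun g _ ↦ ?_
          calc ∑ i, boolSign (g i) * φ i (w g) ≤ ∑ i, |φ i (w g)| := by
                refine Finset.sum_le_sum fun i _ ↦ (le_abs_self _).trans ?_
                rw [abs_mul, abs_boolSign, one_mul]
            _ ≤ K * ‖(w g : Z)‖ := hφ _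
            _ ≤ K * (2 * lam) := by gcongr; exact hw g
            _ = 2 * lam * K := mul_comm _ _
      _ = _ := by simp
  rw [← hsum] at hle
  exact le_of_mul_le_mul_left hle (by positivity)

/-- An infinite-dimensional `L∞`-subspace contains the spaces `ℓ¹ᵏ` with uniform constants, witnessed
by functionals taking all sign patterns on the basis. -/
theorem exists_signed_functionals {X : Type*} [NormedAddCommGroup X] [NormedSpace ℝ X]
    {Z : Submodule ℝ X} (hinf : ¬ FiniteDimensional ℝ Z) (hZ : IsLinftySpace Z) :
    ∃ lam : ℝ, 0 ≤ lam ∧ ∀ k : ℕ, ∃ (e : Fin k → X) (ψ : (Fin k → Bool) → X →L[ℝ] ℝ),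
      (∀ i, e i ∈ Z) ∧ (∀ i, ‖e i‖ ≤ 1) ∧ (∀ s i, ψ s (e i) = boolSign (s i)) ∧
        ∀ s, ‖ψ s‖ ≤ lam := by
  obtain ⟨lam, hlam, h⟩ := hZ
  refine ⟨lam, by positivity, fun k ↦ ?_⟩
  obtain ⟨S, hScard, hS⟩ : ∃ S : Finset Z, S.card = Fintype.card (Fin k → Bool) ∧
      LinearIndepOn ℝ id (S : Set Z) := by
    refine exists_finset_linearIndependent_of_le_rank ?_
    refine (Cardinal.natCast_lt_aleph0.le).trans ?_
    rw [← not_lt, Module.rank_lt_aleph0_iff]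
    exact hinf
  obtain ⟨F, _, hF, T, hT⟩ := h (Submodule.span ℝ (S : Set Z))
    (FiniteDimensional.span_finset ℝ S)
  set T₁ := (T : F →L[ℝ] (Fin (Module.finrank ℝ F) → ℝ))
  set T₂ := (T.symm : (Fin (Module.finrank ℝ F) → ℝ) →L[ℝ] F)
  have hcard : Fintype.card (Fin k → Bool) ≤ Fintype.card (Fin (Module.finrank ℝ F)) := by
    rw [Fintype.card_fin, ← hScard, ← finrank_span_finset_eq_card hS]
    exact Submodule.finrank_mono hF
  obtain ⟨ι⟩ := Function.Embedding.nonempty_of_card_le hcard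
  have hπ : Function.LeftInverse (Function.invFun ι) ι := Function.leftInverse_invFun ι.injective
  set π := Function.invFun ι
  let r : Fin k → Fin (Module.finrank ℝ F) → ℝ := fun i l ↦ boolSign (π l i)
  have hr : ∀ i, ‖r i‖ ≤ 1 := fun i ↦
    (pi_norm_le_iff_of_nonneg zero_le_one).2 fun l ↦ (abs_boolSign _).le
  have hT₂pos : 0 < ‖T₂‖ := by
    refine (norm_nonneg T₂).lt_of_ne fun hnorm ↦ ?_
    have h1 : T₂ 1 = 0 := norm_le_zero_iff.1 <| by simpa [← hnorm] using T₂.le_opNorm 1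
    have h2 : (1 : Fin (Module.finrank ℝ F) → ℝ) = 0 := T.symm.map_eq_zero_iff.1 h1
    exact one_ne_zero (congrFun h2 (ι fun _ ↦ true))
  have hext : ∀ s : Fin k → Bool, ∃ ψ : X →L[ℝ] ℝ, ‖ψ‖ ≤ lam ∧
      ∀ x : F, ψ ((x : Z) : X) = ‖T₂‖ * T₁ x (ι s) := by
    intro s
    let f : F →L[ℝ] ℝ := ‖T₂‖ • (ContinuousLinearMap.proj (ι s)).comp T₁
    have hf : ‖f‖ ≤ lam := by
      refine ContinuousLinearMap.opNorm_le_bound _ (by positivity) fun x ↦ ?_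
      calc ‖f x‖ = ‖T₂‖ * ‖T₁ x (ι s)‖ := by
            change ‖‖T₂‖ * T₁ x (ι s)‖ = _
            rw [norm_mul, Real.norm_of_nonneg (norm_nonneg T₂)]
        _ ≤ ‖T₂‖ * (‖T₁‖ * ‖x‖) := by
          gcongr
          exact (norm_le_pi_norm _ _).trans (T₁.le_opNorm x)
        _ = ‖T₁‖ * ‖T₂‖ * ‖x‖ := by ring
        _ ≤ lam * ‖x‖ := by gcongr
    obtain ⟨g, hg, hgn⟩ := exists_extension_norm_eq F f
    obtain ⟨ψ, hψ, hψn⟩ := exists_extension_norm_eq Z g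
    refine ⟨ψ, by rwa [hψn, hgn], fun x ↦ ?_⟩
    rw [hψ, hg]
    simp [f]
  choose ψ hψ hψF using hext
  refine ⟨fun i ↦ ((‖T₂‖⁻¹ • T₂ (r i) : F) : Z), ψ, fun i ↦ Subtype.prop _, fun i ↦ ?_,
    fun s i ↦ ?_, hψ⟩
  · have : ‖‖T₂‖⁻¹ • T₂ (r i)‖ ≤ 1 := by
      rw [norm_smul, norm_inv, Real.norm_of_nonneg hT₂pos.le, inv_mul_le_one₀ hT₂pos]
      exact T₂.le_of_opNorm_le_of_le le_rfl (hr i) |>.trans_eq (mul_one _)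
    exact this
  · have h1 : T₁ (T₂ (r i)) = r i := T.apply_symm_apply _
    rw [hψF, map_smul, h1, Pi.smul_apply, smul_eq_mul, mul_inv_cancel_left₀ hT₂pos.ne']
    simp only [r]
    rw [hπ s]

theorem not_finiteDimensional_inf_ker {X V : Type*} [AddCommGroup X] [Module ℝ X]
    [AddCommGroup V] [Module ℝ V] [FiniteDimensional ℝ V] {Y : Submodule ℝ X}
    (hY : ¬ FiniteDimensional ℝ Y) (f : X →ₗ[ℝ] V) :
    ¬ FiniteDimensional ℝ (Y ⊓ LinearMap.ker f : Submodule ℝ X) := by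
  intro h
  refine hY (Module.Finite.iff_fg.2 (Submodule.fg_of_fg_map_of_fg_inf_ker f ?_ ?_))
  · exact IsNoetherian.noetherian _
  · exact Module.Finite.iff_fg.1 h

/-- A system of vectors in `W` and functionals whose `ℓ¹`-sum is small on `Y`, which by
`exists_sqrt_le_of_isLinftySpace` prevents the spaces between `W` and `Y` from being `L∞`-spaces
with constant at most a multiple of `n`. -/
def LinftyObstruction {X : Type*} [NormedAddCommGroup X] [NormedSpace ℝ X]
    (W Y : Submodule ℝ X) (n : ℕ) : Prop :=
  ∃ (k : ℕ) (e : Fin k → X) (φ : Fin k → X →L[ℝ] ℝ) (K : ℝ), 0 ≤ K ∧ n * K < √k ∧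
    (∀ i, e i ∈ W) ∧ (∀ i, ‖e i‖ ≤ 1) ∧ (∀ i, φ i (e i) = 1) ∧
      ∀ y ∈ Y, ∑ i, |φ i y| ≤ K * ‖y‖

/-- If all infinite-dimensional closed subspaces are `L∞`-spaces, then between a finite-dimensional
and an infinite-dimensional closed subspace one can insert a pair with an obstruction. -/
theorem exists_linftyObstruction {X : Type*} [NormedAddCommGroup X] [NormedSpace ℝ X]
    (h : ∀ Y : Submodule ℝ X, IsClosed (Y : Set X) → ¬ FiniteDimensional ℝ Y →
      IsLinftySpace Y)
    (W Y : Submodule ℝ X) (hW : FiniteDimensional ℝ W) (hY : IsClosed (Y : Set X))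
    (hYinf : ¬ FiniteDimensional ℝ Y) (hWY : W ≤ Y) (n : ℕ) :
    ∃ W' Y' : Submodule ℝ X, FiniteDimensional ℝ W' ∧ IsClosed (Y' : Set X) ∧
      ¬ FiniteDimensional ℝ Y' ∧ W' ≤ Y' ∧ W < W' ∧ Y' ≤ Y ∧ LinftyObstruction W' Y' n := by
  obtain ⟨P, hP⟩ := Submodule.ClosedComplemented.of_finiteDimensional W
  have hZinf := not_finiteDimensional_inf_ker hYinf (P : X →ₗ[ℝ] W)
  obtain ⟨lam, hlam, hsys⟩ := exists_signed_functionals hZinf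
    (h _ (hY.inter P.isClosed_ker) hZinf)
  let Q : X →L[ℝ] X := ContinuousLinearMap.id ℝ X - W.subtypeL.comp P
  have hQW : ∀ w ∈ W, Q w = 0 := fun w hw ↦ by
    have := hP ⟨w, hw⟩
    simp [Q, this]
  obtain ⟨k, hk⟩ := exists_nat_gt ((n * (lam * ‖Q‖)) ^ 2)
  have hk' : n * (lam * ‖Q‖) < √k := Real.lt_sqrt_of_sq_lt hk
  have hkpos : 0 < k := by
    rw [← Nat.cast_pos (α := ℝ), ← Real.sqrt_pos]
    exact lt_of_le_of_lt (by positivity) hk'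
  obtain ⟨e, ψ, heZ, he, hψe, hψ⟩ := hsys k
  have hPe : ∀ i, P (e i) = 0 := fun i ↦ (heZ i).2
  have hQe : ∀ i, Q (e i) = e i := fun i ↦ by simp [Q, hPe]
  let φ : Fin k → X →L[ℝ] ℝ := fun j ↦ (2⁻¹ : ℝ) •
    (ψ (fun _ ↦ true) - ψ (Function.update (fun _ ↦ true) j false)).comp Q
  have hφe : ∀ i j, φ j (e i) = if i = j then 1 else 0 := by
    intro i j
    by_cases hij : i = j
    · subst hij
      simp [φ, hQe, hψe, boolSign]
      norm_num
    · simp [φ, hQe, hψe, boolSign, hij]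
  obtain ⟨D, hD⟩ : ∃ D : X →L[ℝ] ((Fin k → Bool) → ℝ),
      ∀ y s, D y s = ψ s (Q y) - ∑ j, boolSign (s j) * φ j y :=
    ⟨ContinuousLinearMap.pi fun s ↦ (ψ s).comp Q - ∑ j, boolSign (s j) • φ j,
      fun y s ↦ by simp⟩
  have hWD : ∀ w ∈ W, D w = 0 := fun w hw ↦ by
    ext s
    simp [hD, φ, hQW w hw]
  have heD : ∀ i, D (e i) = 0 := fun i ↦ by
    ext s
    simp [hD, hQe, hφe, hψe]
  have hinf : ¬ FiniteDimensional ℝ (Y ⊓ D.ker : Submodule ℝ X) :=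
    not_finiteDimensional_inf_ker hYinf (D : X →ₗ[ℝ] ((Fin k → Bool) → ℝ))
  refine ⟨W ⊔ Submodule.span ℝ (Set.range e), Y ⊓ D.ker, ?_, hY.inter D.isClosed_ker, hinf,
    ?_, ?_, inf_le_left, ?_⟩
  · have := FiniteDimensional.span_of_finite ℝ (Set.finite_range e)
    infer_instance
  · refine sup_le (fun w hw ↦ ⟨hWY hw, hWD w hw⟩) (Submodule.span_le.2 ?_)
    rintro _ ⟨i, rfl⟩
    exact ⟨(heZ i).1, heD i⟩
  · refine left_lt_sup.2 fun hle ↦ ?_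
    have h0 := hQW _ (hle (Submodule.subset_span ⟨⟨0, hkpos⟩, rfl⟩))
    have h1 := hφe ⟨0, hkpos⟩ ⟨0, hkpos⟩
    rw [hQe] at h0
    simp [h0] at h1
  · refine ⟨k, e, φ, lam * ‖Q‖, by positivity, hk',
      fun i ↦ Submodule.mem_sup_right (Submodule.subset_span ⟨i, rfl⟩), he,
      fun i ↦ by simp [hφe], fun y hy ↦ ?_⟩
    let s : Fin k → Bool := fun j ↦ decide (0 ≤ φ j y)
    have hs : ∀ j, |φ j y| = boolSign (s j) * φ j y := by
      intro j
      by_cases hj : 0 ≤ φ j y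
      · simp [s, boolSign, hj]
      · simp [s, boolSign, hj, abs_of_neg (not_le.1 hj)]
    have hDs : D y s = 0 := congrFun (hy.2 : D y = 0) s
    rw [hD, sub_eq_zero] at hDs
    rw [Finset.sum_congr rfl fun j _ ↦ hs j, ← hDs]
    calc ψ s (Q y) ≤ ‖ψ s (Q y)‖ := le_abs_self _
      _ ≤ lam * (‖Q‖ * ‖y‖) := (ψ s).le_of_opNorm_le_of_le (hψ s) (Q.le_opNorm y)
      _ = lam * ‖Q‖ * ‖y‖ := (mul_assoc _ _ _).symm

/-- There is no infinite-dimensional Banach space all of whose infinite-dimensional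
closed subspaces are `L∞`-spaces. -/
theorem no_banach_space_all_infinite_subspaces_Linfty
    {X : Type*} [NormedAddCommGroup X] [NormedSpace ℝ X] [CompleteSpace X]
    (hinf : ¬ FiniteDimensional ℝ X)
    (h : ∀ Y : Submodule ℝ X, IsClosed (Y : Set X) → ¬ FiniteDimensional ℝ Y →
      IsLinftySpace Y) :
    False := by
  let S := {p : Submodule ℝ X × Submodule ℝ X // FiniteDimensional ℝ p.1 ∧
    IsClosed (p.2 : Set X) ∧ ¬ FiniteDimensional ℝ p.2 ∧ p.1 ≤ p.2}
  have hstep : ∀ (n : ℕ) (p : S), ∃ q : S, p.1.1 < q.1.1 ∧ q.1.2 ≤ p.1.2 ∧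
      LinftyObstruction q.1.1 q.1.2 n := by
    rintro n ⟨⟨W, Y⟩, hW, hY, hYinf, hWY⟩
    obtain ⟨W', Y', h1, h2, h3, h4, h5, h6, h7⟩ :=
      exists_linftyObstruction h W Y hW hY hYinf hWY n
    exact ⟨⟨(W', Y'), h1, h2, h3, h4⟩, h5, h6, h7⟩
  choose next hlt hle hobs using hstep
  let start : S := ⟨(⊥, ⊤), inferInstance, isClosed_univ,
    fun hfin ↦ hinf (Module.finite_def.2 (Module.Finite.iff_fg.1 hfin)), bot_le⟩
  let seq : ℕ → S := fun n ↦ Nat.rec start next n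
  have hWmono : StrictMono fun n ↦ (seq n).1.1 := strictMono_nat_of_lt_succ fun n ↦ hlt n (seq n)
  have hYanti : Antitone fun n ↦ (seq n).1.2 := antitone_nat_of_succ_le fun n ↦ hle n (seq n)
  let Y : Submodule ℝ X := ⨅ n, (seq n).1.2
  have hWY : ∀ n, (seq n).1.1 ≤ Y := fun n ↦ le_iInf fun m ↦
    calc (seq n).1.1 ≤ (seq (max n m)).1.1 := hWmono.monotone (le_max_left n m)
      _ ≤ (seq (max n m)).1.2 := (seq (max n m)).2.2.2.2
      _ ≤ (seq m).1.2 := hYanti (le_max_right n m)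
  have hYclosed : IsClosed (Y : Set X) := by
    rw [Submodule.coe_iInf]
    exact isClosed_iInter fun n ↦ (seq n).2.2.1
  have hYinf : ¬ FiniteDimensional ℝ Y := by
    intro hfin
    have hrank : StrictMono fun n ↦ Module.finrank ℝ (seq n).1.1 := fun m n hmn ↦
      have := (seq n).2.1
      Submodule.finrank_lt_finrank_of_lt (hWmono hmn)
    have h1 := hrank.le_apply (x := Module.finrank ℝ Y + 1)
    have h2 := Submodule.finrank_mono (hWY (Module.finrank ℝ Y + 1))
    omega
  obtain ⟨lam, hlam, hbound⟩ := exists_sqrt_le_of_isLinftySpace (h Y hYclosed hYinf)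
  obtain ⟨n, hn⟩ := exists_nat_ge lam
  obtain ⟨k, e, φ, K, hK, hk, heW, he, hφe, hφ⟩ := hobs n (seq n)
  have hsqrt := hbound k (fun i ↦ ⟨e i, hWY (n + 1) (heW i)⟩) (fun i ↦ (φ i).comp Y.subtypeL) K hK
    he hφe fun y ↦ hφ y (Submodule.mem_iInf _ |>.1 y.2 (n + 1))
  have : lam * K ≤ n * K := by gcongr
  linarith
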